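/- For any integer n ≥ 2: Φ(n,0) = 0, the sequence Φ(n,0), Φ(n,1), …, Φ(n,2^{n−2}) is strictly increasing, and Φ(n,2^{n−2}) = 3·2^{n−2}. -/

import Mathlib

open Finset

/-- The ground set `[n] = {1, …, n}`. -/
def groundSet (n : ℕ) : Finset ℕ := Finset.Icc 1 n

/-- The up-closure `𝓕↑` of a family `F` with respect to ground set `X`. -/
def upClo (X : Finset ℕ) (F : Finset (Finset ℕ)) : Finset (Finset ℕ) :=
  X.powerset.filter (fun S => ∃ A ∈ F, A ⊆ S)

/-- The down-closure `𝓕↓` of a family `F` with respect to ground set `X`. -/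
def downClo (X : Finset ℕ) (F : Finset (Finset ℕ)) : Finset (Finset ℕ) :=
  X.powerset.filter (fun S => ∃ A ∈ F, S ⊆ A)

/-- `𝓕↕ = 𝓕↑ ∪ 𝓕↓` with respect to ground set `X`. -/
def udClo (X : Finset ℕ) (F : Finset (Finset ℕ)) : Finset (Finset ℕ) :=
  upClo X F ∪ downClo X F

/-- `Φ(n,m)`: the minimum of `|𝓕↕|` over families `𝓕 ⊆ 2^[n]` with `|𝓕| = m`,
closures taken w.r.t. the ground set `[n]`. -/
noncomputable def Phi (n m : ℕ) : ℕ :=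
  sInf {k | ∃ F : Finset (Finset ℕ),
    F ⊆ (groundSet n).powerset ∧ F.card = m ∧ (udClo (groundSet n) F).card = k}

/-- The number of `x < 2 ^ n` with `x ≥ 2 ^ n - u` whose `n`-bit reversal is less than `d`
(for `u, d ≤ 2 ^ n`). It is the largest possible intersection of an up-set of size `u` and a
down-set of size `d` in the cube of dimension `n`. -/
def bitRevCount : ℕ → ℕ → ℕ → ℕ
  | 0, u, d => min u d
  | n + 1, u, d =>
    if u ≤ 2 ^ n then bitRevCount n u (d / 2)
    else d / 2 + bitRevCount n (u - 2 ^ n) ((d + 1) / 2)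

namespace bitRevCount

theorem succ_of_le {n u : ℕ} (d : ℕ) (h : u ≤ 2 ^ n) :
    bitRevCount (n + 1) u d = bitRevCount n u (d / 2) := by
  simp [bitRevCount, h]

theorem zero_left (n d : ℕ) : bitRevCount n 0 d = 0 := by
  induction n generalizing d with
  | zero => simp [bitRevCount]
  | succ n ih => rw [succ_of_le d (Nat.zero_le _), ih]

theorem full_left (n d : ℕ) (hd : d ≤ 2 ^ n) : bitRevCount n (2 ^ n) d = d := by
  induction n generalizing d with
  | zero => simpa [bitRevCount] using hd
  | succ n ih =>
    have hp : 0 < 2 ^ n := by positivity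
    rw [pow_succ] at hd
    have h : ¬ 2 ^ (n + 1) ≤ 2 ^ n := by rw [pow_succ]; omega
    have h' : 2 ^ (n + 1) - 2 ^ n = 2 ^ n := by rw [pow_succ]; omega
    rw [bitRevCount, if_neg h, h', ih _ (by omega)]
    omega

theorem zero_right (n u : ℕ) : bitRevCount n u 0 = 0 := by
  induction n generalizing u with
  | zero => simp [bitRevCount]
  | succ n ih => simp [bitRevCount, ih]

theorem full_right (n u : ℕ) (hu : u ≤ 2 ^ n) : bitRevCount n u (2 ^ n) = u := by
  induction n generalizing u with
  | zero => simpa [bitRevCount] using hu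
  | succ n ih =>
    have hp : 2 ^ (n + 1) = 2 * 2 ^ n := by ring
    have h1 : 2 ^ (n + 1) / 2 = 2 ^ n := by omega
    have h2 : (2 ^ (n + 1) + 1) / 2 = 2 ^ n := by omega
    rw [bitRevCount, h1, h2]
    split_ifs with h
    · exact ih u h
    · rw [ih _ (by omega)]
      omega

theorem succ_of_ge {n u d : ℕ} (h : 2 ^ n ≤ u) (hd : d ≤ 2 ^ (n + 1)) :
    bitRevCount (n + 1) u d = d / 2 + bitRevCount n (u - 2 ^ n) ((d + 1) / 2) := by
  rcases h.eq_or_lt with rfl | h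
  · rw [succ_of_le _ le_rfl, full_left _ _ (by rw [pow_succ] at hd; omega), Nat.sub_self,
      zero_left, add_zero]
  · rw [bitRevCount, if_neg (by omega)]

theorem step_right (n u d : ℕ) : bitRevCount n u d ≤ bitRevCount n u (d + 1) ∧
    bitRevCount n u (d + 1) ≤ bitRevCount n u d + 1 := by
  induction n generalizing u d with
  | zero => simp only [bitRevCount]; omega
  | succ n ih =>
    have h1 := ih u (d / 2)
    have h2 := ih (u - 2 ^ n) ((d + 1) / 2)
    rcases Nat.even_or_odd' d with ⟨k, rfl | rfl⟩
    · have e1 : (2 * k + 1) / 2 = k := by omega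
      have e2 : 2 * k / 2 = k := by omega
      have e3 : (2 * k + 1 + 1) / 2 = k + 1 := by omega
      simp only [bitRevCount, e1, e2, e3] at *
      split_ifs <;> omega
    · have e1 : (2 * k + 1) / 2 = k := by omega
      have e2 : (2 * k + 1 + 1) / 2 = k + 1 := by omega
      have e3 : (2 * k + 1 + 1 + 1) / 2 = k + 1 := by omega
      simp only [bitRevCount, e1, e2, e3] at *
      split_ifs <;> omega

theorem mono_right (n u : ℕ) {d d' : ℕ} (h : d ≤ d') :
    bitRevCount n u d ≤ bitRevCount n u d' :=
  monotone_nat_of_le_succ (fun d => (step_right n u d).1) h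

theorem right_le_add_sub (n u : ℕ) {d d' : ℕ} (h : d ≤ d') :
    bitRevCount n u d' ≤ bitRevCount n u d + (d' - d) := by
  induction d', h using Nat.le_induction with
  | base => omega
  | succ k hk ih => have := (step_right n u k).2; omega

theorem succ_right {n : ℕ} : ∀ {u d : ℕ}, u ≤ 2 ^ (n + 1) → d ≤ 2 ^ (n + 1) →
    bitRevCount (n + 1) u d = if d ≤ 2 ^ n then bitRevCount n (u / 2) d
      else u / 2 + bitRevCount n ((u + 1) / 2) (d - 2 ^ n) := by
  induction n with
  | zero =>
    intro u d hu hd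
    simp only [zero_add, pow_one] at hu hd
    interval_cases u <;> interval_cases d <;> simp [bitRevCount]
  | succ n ih =>
    intro u d hu hd
    have hp : 2 ^ (n + 1) = 2 * 2 ^ n := by ring
    have hp' : 2 ^ (n + 1 + 1) = 4 * 2 ^ n := by ring
    rw [hp'] at hu hd
    have e2 : (u - 2 * 2 ^ n) / 2 = u / 2 - 2 ^ n := by omega
    have e3 : (d - 2 * 2 ^ n) / 2 = d / 2 - 2 ^ n := by omega
    by_cases h1 : u ≤ 2 ^ (n + 1)
    · rw [succ_of_le _ h1, ih h1 (by omega)]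
      by_cases h2 : d ≤ 2 ^ (n + 1)
      · rw [if_pos (by omega), if_pos h2, succ_of_le _ (by omega)]
      · rw [if_neg h2, succ_of_le (u := (u + 1) / 2) _ (by omega), hp, e3]
        split_ifs with h3
        · have e4 : d / 2 = 2 ^ n := by omega
          rw [e4, full_right _ _ (by omega), Nat.sub_self, zero_right, add_zero]
        · rfl
    · rw [succ_of_ge (by omega) (by omega), ih (by omega) (by omega)]
      by_cases h2 : d ≤ 2 ^ (n + 1)
      · rw [if_pos (by omega), if_pos h2, succ_of_ge (by omega) (by omega), hp, e2]
      · rw [if_neg h2, succ_of_ge (by omega) (by omega), hp]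
        have e5 : (u - 2 * 2 ^ n + 1) / 2 = (u + 1) / 2 - 2 ^ n := by omega
        have e6 : (d - 2 * 2 ^ n + 1) / 2 = (d + 1) / 2 - 2 ^ n := by omega
        split_ifs with h3
        · have e7 : (d + 1) / 2 - 2 ^ n = 0 := by omega
          omega
        · rw [e5, e6, e3]
          omega

theorem comm {n : ℕ} : ∀ {u d : ℕ}, u ≤ 2 ^ n → d ≤ 2 ^ n →
    bitRevCount n u d = bitRevCount n d u := by
  induction n with
  | zero => intro u d _ _; simp [bitRevCount, min_comm]
  | succ n ih =>
    intro u d hu hd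
    rw [succ_right hd hu, bitRevCount]
    rw [pow_succ] at hu hd
    split_ifs with h
    · exact ih h (by omega)
    · rw [ih (by omega) (by omega)]

theorem succ_of_right_le {n u d : ℕ} (hu : u ≤ 2 ^ (n + 1)) (hd : d ≤ 2 ^ n) :
    bitRevCount (n + 1) u d = bitRevCount n (u / 2) d := by
  rw [succ_right hu (hd.trans (Nat.pow_le_pow_right two_pos n.le_succ)), if_pos hd]

theorem succ_of_right_ge {n u d : ℕ} (hu : u ≤ 2 ^ (n + 1)) (hd : d ≤ 2 ^ (n + 1))
    (h : 2 ^ n ≤ d) :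
    bitRevCount (n + 1) u d = u / 2 + bitRevCount n ((u + 1) / 2) (d - 2 ^ n) := by
  have hp : 2 ^ (n + 1) = 2 * 2 ^ n := by ring
  rw [comm hu hd, succ_of_ge h hu, comm (by omega) (by omega)]

theorem mono_left {n u u' d : ℕ} (h : u ≤ u') (hu : u' ≤ 2 ^ n) (hd : d ≤ 2 ^ n) :
    bitRevCount n u d ≤ bitRevCount n u' d := by
  rw [comm (h.trans hu) hd, comm hu hd]
  exact mono_right n d h

theorem left_le_add_sub {n u u' d : ℕ} (h : u ≤ u') (hu : u' ≤ 2 ^ n) (hd : d ≤ 2 ^ n) :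
    bitRevCount n u' d ≤ bitRevCount n u d + (u' - u) := by
  rw [comm (h.trans hu) hd, comm hu hd]
  exact right_le_add_sub n d h

theorem le_left {n u d : ℕ} (hu : u ≤ 2 ^ n) (hd : d ≤ 2 ^ n) : bitRevCount n u d ≤ u := by
  simpa [zero_left] using left_le_add_sub (Nat.zero_le u) hu hd

theorem le_right {n u d : ℕ} (hu : u ≤ 2 ^ n) (hd : d ≤ 2 ^ n) : bitRevCount n u d ≤ d := by
  rw [comm hu hd]
  exact le_left hd hu

theorem compl {n u d : ℕ} (hu : u ≤ 2 ^ n) (hd : d ≤ 2 ^ n) :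
    bitRevCount n (2 ^ n - u) (2 ^ n - d) + u + d = 2 ^ n + bitRevCount n u d := by
  induction n generalizing u d with
  | zero =>
    simp only [pow_zero] at hu hd
    interval_cases u <;> interval_cases d <;> simp [bitRevCount]
  | succ n ih =>
    have hp : 2 ^ (n + 1) = 2 * 2 ^ n := by ring
    have e1 : (2 ^ (n + 1) - d) / 2 = 2 ^ n - (d + 1) / 2 := by omega
    have e2 : (2 ^ (n + 1) - d + 1) / 2 = 2 ^ n - d / 2 := by omega
    by_cases h : u ≤ 2 ^ n
    · have e3 : 2 ^ (n + 1) - u - 2 ^ n = 2 ^ n - u := by omega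
      have := ih h (show d / 2 ≤ 2 ^ n by omega)
      rw [succ_of_le _ h, succ_of_ge (by omega) (by omega), e1, e2, e3]
      omega
    · have e3 : 2 ^ (n + 1) - u = 2 ^ n - (u - 2 ^ n) := by omega
      have := ih (show u - 2 ^ n ≤ 2 ^ n by omega) (show (d + 1) / 2 ≤ 2 ^ n by omega)
      rw [succ_of_ge (u := u) (by omega) hd, succ_of_le _ (by omega), e1, e3]
      omega

theorem add_le_succ_of_add_le_half {n : ℕ}
    (hT : ∀ {a b e f : ℕ}, a ≤ b → a + b ≤ 2 ^ n → e ≤ f → f ≤ 2 ^ n →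
      bitRevCount n a f + bitRevCount n b e ≤ bitRevCount n (a + b) ((e + f) / 2))
    {a b e f : ℕ} (hab : a ≤ b) (hb : b ≤ 2 ^ n) (hef : e ≤ f) (hf : f ≤ 2 ^ n) :
    bitRevCount n a f + bitRevCount n b e ≤ bitRevCount (n + 1) (a + b) (e + f) := by
  have hp : 2 ^ (n + 1) = 2 * 2 ^ n := by ring
  by_cases h1 : a + b ≤ 2 ^ n
  · rw [succ_of_le _ h1]
    exact hT hab h1 hef hf
  by_cases h2 : e + f ≤ 2 ^ n
  · have := hT hef h2 hab hb
    rw [comm (n := n + 1) (by omega) (by omega), succ_of_le _ h2, comm (u := a) (by omega) hf,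
      comm hb (by omega)]
    omega
  have h3 := hT (show 2 ^ n - b ≤ 2 ^ n - a by omega) (by omega)
    (show 2 ^ n - f ≤ 2 ^ n - e by omega) (by omega)
  have e1 : 2 ^ n - b + (2 ^ n - a) = 2 ^ (n + 1) - (a + b) := by omega
  have e2 : 2 ^ n - f + (2 ^ n - e) = 2 ^ (n + 1) - (e + f) := by omega
  rw [e1, e2, ← succ_of_le _ (by omega)] at h3
  have := compl (show a + b ≤ 2 ^ (n + 1) by omega) (show e + f ≤ 2 ^ (n + 1) by omega)
  have := compl (show a ≤ 2 ^ n by omega) hf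
  have := compl hb (show e ≤ 2 ^ n by omega)
  omega

theorem add_le_half {n a b e f : ℕ} (hab : a ≤ b) (h : a + b ≤ 2 ^ n) (hef : e ≤ f)
    (hf : f ≤ 2 ^ n) :
    bitRevCount n a f + bitRevCount n b e ≤ bitRevCount n (a + b) ((e + f) / 2) := by
  induction n generalizing a b e f with
  | zero =>
    have : a = 0 := by simp at h; omega
    subst this
    simpa [zero_left] using mono_right 0 b (show e ≤ (e + f) / 2 by omega)
  | succ n ih =>
    have hp : 2 ^ (n + 1) = 2 * 2 ^ n := by ring
    by_cases hb : b ≤ 2 ^ n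
    · rw [succ_of_le _ hb, succ_of_le _ (hab.trans hb)]
      refine (add_le_succ_of_add_le_half ih hab hb (show e / 2 ≤ f / 2 by omega)
        (by omega)).trans (mono_right _ _ (by omega))
    have hlow : ∀ {e f : ℕ}, e ≤ f → f ≤ 2 ^ n → bitRevCount (n + 1) a f +
        bitRevCount (n + 1) b e ≤ bitRevCount (n + 1) (a + b) ((e + f) / 2) := by
      intro e f hef hf
      rw [succ_of_right_le (by omega) hf, succ_of_right_le (by omega) (hef.trans hf),
        succ_of_right_le (by omega) (by omega)]
      exact (ih (by omega) (by omega) hef hf).trans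
        (mono_left (by omega) (by omega) (by omega))
    have hhigh : ∀ {e f : ℕ}, 2 ^ n ≤ e → e ≤ f → f ≤ 2 ^ (n + 1) → bitRevCount (n + 1) a f +
        bitRevCount (n + 1) b e ≤ bitRevCount (n + 1) (a + b) ((e + f) / 2) := by
      intro e f he hef hf
      rw [succ_of_right_ge (by omega) hf (by omega), succ_of_right_ge (by omega) (by omega) he,
        succ_of_right_ge (by omega) (by omega) (by omega)]
      have e1 : (e - 2 ^ n + (f - 2 ^ n)) / 2 = (e + f) / 2 - 2 ^ n := by omega
      by_cases hodd : a % 2 = 1 ∧ b % 2 = 1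
      · have h1 := ih (show (a + 1) / 2 ≤ b / 2 by omega) (by omega)
          (show e - 2 ^ n ≤ f - 2 ^ n by omega) (by omega)
        have h2 := left_le_add_sub (show b / 2 ≤ (b + 1) / 2 by omega) (by omega)
          (show e - 2 ^ n ≤ 2 ^ n by omega)
        have e2 : (a + 1) / 2 + b / 2 = (a + b + 1) / 2 := by omega
        rw [e1, e2] at h1
        omega
      · have h1 := ih (show (a + 1) / 2 ≤ (b + 1) / 2 by omega) (by omega)
          (show e - 2 ^ n ≤ f - 2 ^ n by omega) (by omega)
        have e2 : (a + 1) / 2 + (b + 1) / 2 = (a + b + 1) / 2 := by omega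
        rw [e1, e2] at h1
        omega
    by_cases hf' : f ≤ 2 ^ n
    · exact hlow hef hf'
    by_cases he' : 2 ^ n ≤ e
    · exact hhigh he' hef hf
    rcases Nat.eq_zero_or_pos a with rfl | ha
    · simpa [zero_left] using mono_right (n + 1) b (show e ≤ (e + f) / 2 by omega)
    obtain ⟨q, hq⟩ : ∃ q, 2 ^ n = 2 * q := by
      cases n with
      | zero => omega
      | succ n => exact ⟨2 ^ n, by ring⟩
    by_cases hδ : 2 ^ (n + 1) ≤ e + f
    · refine le_trans ?_ ((hhigh le_rfl (show 2 ^ n ≤ e + f - 2 ^ n by omega)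
        (by omega)).trans_eq (by congr 2; omega))
      rw [succ_of_le (u := a) _ (by omega), succ_of_le (u := a) _ (by omega),
        succ_of_ge (u := b) (by omega) (by omega), succ_of_ge (u := b) (by omega) (by omega)]
      have h1 := right_le_add_sub n a (show (e + f - 2 ^ n) / 2 ≤ f / 2 by omega)
      have h2 := mono_right n (b - 2 ^ n) (show (e + 1) / 2 ≤ (2 ^ n + 1) / 2 by omega)
      omega
    · refine le_trans ?_ ((hlow (show e + f - 2 ^ n ≤ 2 ^ n by omega)
        le_rfl).trans_eq (by congr 2; omega))
      rw [succ_of_le (u := a) _ (by omega), succ_of_le (u := a) _ (by omega),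
        succ_of_ge (u := b) (by omega) (by omega), succ_of_ge (u := b) (by omega) (by omega)]
      have h1 := right_le_add_sub n a (show 2 ^ n / 2 ≤ f / 2 by omega)
      have h2 := mono_right n (b - 2 ^ n)
        (show (e + 1) / 2 ≤ (e + f - 2 ^ n + 1) / 2 by omega)
      omega

theorem add_le_succ {n a b e f : ℕ} (hab : a ≤ b) (hb : b ≤ 2 ^ n) (hef : e ≤ f)
    (hf : f ≤ 2 ^ n) :
    bitRevCount n a f + bitRevCount n b e ≤ bitRevCount (n + 1) (a + b) (e + f) :=
  add_le_succ_of_add_le_half add_le_half hab hb hef hf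

theorem mul_two_pow_le {n u d : ℕ} (hu : u ≤ 2 ^ n) (hd : d ≤ 2 ^ n) :
    bitRevCount n u d * 2 ^ n ≤ u * d := by
  induction n generalizing u d with
  | zero =>
    simp only [pow_zero] at hu hd
    interval_cases u <;> interval_cases d <;> simp [bitRevCount]
  | succ n ih =>
    have hp : 2 ^ (n + 1) = 2 * 2 ^ n := by ring
    by_cases h : u ≤ 2 ^ n
    · have h1 := ih h (show d / 2 ≤ 2 ^ n by omega)
      rw [succ_of_le _ h, hp]
      nlinarith [Nat.mul_le_mul_left u (Nat.div_mul_le_self d 2)]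
    · have h1 := ih (show u - 2 ^ n ≤ 2 ^ n by omega) (show (d + 1) / 2 ≤ 2 ^ n by omega)
      rw [succ_of_ge (by omega) hd, hp]
      obtain ⟨v, rfl⟩ : ∃ v, u = 2 ^ n + v := ⟨u - 2 ^ n, by omega⟩
      rw [Nat.add_sub_cancel_left] at h1 ⊢
      rcases Nat.even_or_odd' d with ⟨k, rfl | rfl⟩
      · have e1 : (2 * k + 1) / 2 = k := by omega
        have e2 : 2 * k / 2 = k := by omega
        rw [e1] at h1 ⊢
        rw [e2]
        nlinarith
      · have e1 : (2 * k + 1) / 2 = k := by omega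
        have e2 : (2 * k + 1 + 1) / 2 = k + 1 := by omega
        rw [e2] at h1 ⊢
        rw [e1]
        nlinarith

end bitRevCount

section Families

variable {α : Type*}

/-- `U` is a family of subsets of `s` that is closed under taking larger subsets of `s`. -/
def IsUpperIn (s : Finset α) (U : Finset (Finset α)) : Prop :=
  U ⊆ s.powerset ∧ ∀ ⦃A B⦄, A ∈ U → A ⊆ B → B ⊆ s → B ∈ U

/-- `D` is a family of subsets of `s` that is closed under taking subsets. -/
def IsLowerIn (s : Finset α) (D : Finset (Finset α)) : Prop :=
  D ⊆ s.powerset ∧ ∀ ⦃A B⦄, A ∈ D → B ⊆ A → B ∈ D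

theorem IsLowerIn.isLowerSet {s : Finset α} {D : Finset (Finset α)} (h : IsLowerIn s D) :
    IsLowerSet (D : Set (Finset α)) :=
  fun _ _ hBA hA => h.2 hA hBA

theorem card_le_two_pow_of_subset_powerset {s : Finset α} {A : Finset (Finset α)}
    (hA : A ⊆ s.powerset) : #A ≤ 2 ^ #s :=
  (card_le_card hA).trans_eq (card_powerset s)

variable [DecidableEq α]

theorem nonMemberSubfamily_subset_powerset {a : α} {s : Finset α} {A : Finset (Finset α)}
    (hA : A ⊆ (insert a s).powerset) : A.nonMemberSubfamily a ⊆ s.powerset := by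
  intro B hB
  rw [mem_nonMemberSubfamily] at hB
  exact mem_powerset.2 ((subset_insert_iff_of_notMem hB.2).1 (mem_powerset.1 (hA hB.1)))

theorem memberSubfamily_subset_powerset {a : α} {s : Finset α} {A : Finset (Finset α)}
    (hA : A ⊆ (insert a s).powerset) : A.memberSubfamily a ⊆ s.powerset := by
  intro B hB
  rw [mem_memberSubfamily] at hB
  exact mem_powerset.2 ((subset_insert_iff_of_notMem hB.2).1
    ((subset_insert _ _).trans (mem_powerset.1 (hA hB.1))))

namespace IsUpperIn

variable {a : α} {s : Finset α} {U : Finset (Finset α)}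

theorem nonMemberSubfamily (h : IsUpperIn (insert a s) U) (ha : a ∉ s) :
    IsUpperIn s (U.nonMemberSubfamily a) := by
  refine ⟨nonMemberSubfamily_subset_powerset h.1, fun A B hA hAB hB => ?_⟩
  rw [mem_nonMemberSubfamily] at hA ⊢
  exact ⟨h.2 hA.1 hAB (hB.trans (subset_insert _ _)), fun h' => ha (hB h')⟩

theorem memberSubfamily (h : IsUpperIn (insert a s) U) (ha : a ∉ s) :
    IsUpperIn s (U.memberSubfamily a) := by
  refine ⟨memberSubfamily_subset_powerset h.1, fun A B hA hAB hB => ?_⟩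
  rw [mem_memberSubfamily] at hA ⊢
  exact ⟨h.2 hA.1 (insert_subset_insert _ hAB) (insert_subset_insert _ hB), fun h' => ha (hB h')⟩

theorem nonMemberSubfamily_subset_memberSubfamily (h : IsUpperIn (insert a s) U) :
    U.nonMemberSubfamily a ⊆ U.memberSubfamily a := by
  intro A hA
  rw [mem_nonMemberSubfamily] at hA
  rw [mem_memberSubfamily]
  exact ⟨h.2 hA.1 (subset_insert _ _)
    (insert_subset (mem_insert_self _ _) (mem_powerset.1 (h.1 hA.1))), hA.2⟩

end IsUpperIn

namespace IsLowerIn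

variable {a : α} {s : Finset α} {D : Finset (Finset α)}

theorem nonMemberSubfamily (h : IsLowerIn (insert a s) D) :
    IsLowerIn s (D.nonMemberSubfamily a) :=
  ⟨nonMemberSubfamily_subset_powerset h.1, fun _ _ hA hBA => h.isLowerSet.nonMemberSubfamily hBA hA⟩

theorem memberSubfamily (h : IsLowerIn (insert a s) D) : IsLowerIn s (D.memberSubfamily a) :=
  ⟨memberSubfamily_subset_powerset h.1, fun _ _ hA hBA => h.isLowerSet.memberSubfamily hBA hA⟩

end IsLowerIn

theorem card_inter_le_bitRevCount {s : Finset α} {U D : Finset (Finset α)}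
    (hU : IsUpperIn s U) (hD : IsLowerIn s D) : #(U ∩ D) ≤ bitRevCount #s #U #D := by
  induction s using Finset.induction generalizing U D with
  | empty =>
    rw [card_empty, bitRevCount]
    exact le_min (card_le_card inter_subset_left) (card_le_card inter_subset_right)
  | insert a s ha ih =>
    have h0 := ih (hU.nonMemberSubfamily ha) hD.nonMemberSubfamily
    have h1 := ih (hU.memberSubfamily ha) hD.memberSubfamily
    have h2 := bitRevCount.add_le_succ (n := #s)
      (card_le_card hU.nonMemberSubfamily_subset_memberSubfamily)
      (card_le_two_pow_of_subset_powerset (hU.memberSubfamily ha).1)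
      (card_le_card (hD.isLowerSet.memberSubfamily_subset_nonMemberSubfamily (a := a)))
      (card_le_two_pow_of_subset_powerset hD.nonMemberSubfamily.1)
    rw [card_memberSubfamily_add_card_nonMemberSubfamily, add_comm (#(U.nonMemberSubfamily a)),
      card_memberSubfamily_add_card_nonMemberSubfamily] at h2
    rw [card_insert_of_notMem ha, ← card_memberSubfamily_add_card_nonMemberSubfamily a (U ∩ D),
      memberSubfamily_inter, nonMemberSubfamily_inter]
    omega

/-- The family of subsets of `insert a s` whose members containing `a` are the `insert a B` with
`B ∈ A₁` and whose members avoiding `a` are those of `A₀`. -/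
def joinFamily (a : α) (s : Finset α) (A₀ A₁ : Finset (Finset α)) : Finset (Finset α) :=
  (insert a s).powerset.filter fun B => (a ∈ B → B.erase a ∈ A₁) ∧ (a ∉ B → B ∈ A₀)

section joinFamily

variable {a : α} {s : Finset α} {A₀ A₁ B₀ B₁ : Finset (Finset α)}

theorem memberSubfamily_joinFamily (ha : a ∉ s) (h₁ : A₁ ⊆ s.powerset) :
    (joinFamily a s A₀ A₁).memberSubfamily a = A₁ := by
  ext B
  simp only [mem_memberSubfamily, joinFamily, mem_filter, mem_powerset, mem_insert_self,
    not_true_eq_false, false_imp_iff, true_imp_iff, and_true]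
  refine ⟨fun h => by simpa [erase_insert h.2] using h.1.2, fun h => ?_⟩
  have hB := mem_powerset.1 (h₁ h)
  have haB : a ∉ B := fun h' => ha (hB h')
  exact ⟨⟨insert_subset_insert _ hB, by rwa [erase_insert haB]⟩, haB⟩

theorem nonMemberSubfamily_joinFamily (ha : a ∉ s) (h₀ : A₀ ⊆ s.powerset) :
    (joinFamily a s A₀ A₁).nonMemberSubfamily a = A₀ := by
  ext B
  simp only [mem_nonMemberSubfamily, joinFamily, mem_filter, mem_powerset]
  refine ⟨fun h => h.1.2.2 h.2, fun h => ?_⟩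
  have hB := mem_powerset.1 (h₀ h)
  have haB : a ∉ B := fun h' => ha (hB h')
  exact ⟨⟨hB.trans (subset_insert _ _), fun h' => absurd h' haB, fun _ => h⟩, haB⟩

theorem card_joinFamily (ha : a ∉ s) (h₀ : A₀ ⊆ s.powerset) (h₁ : A₁ ⊆ s.powerset) :
    #(joinFamily a s A₀ A₁) = #A₁ + #A₀ := by
  rw [← card_memberSubfamily_add_card_nonMemberSubfamily a, memberSubfamily_joinFamily ha h₁,
    nonMemberSubfamily_joinFamily ha h₀]

theorem card_joinFamily_inter (ha : a ∉ s) (h₀ : A₀ ⊆ s.powerset) (h₁ : A₁ ⊆ s.powerset)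
    (h₀' : B₀ ⊆ s.powerset) (h₁' : B₁ ⊆ s.powerset) :
    #(joinFamily a s A₀ A₁ ∩ joinFamily a s B₀ B₁) = #(A₁ ∩ B₁) + #(A₀ ∩ B₀) := by
  rw [← card_memberSubfamily_add_card_nonMemberSubfamily a, memberSubfamily_inter,
    nonMemberSubfamily_inter, memberSubfamily_joinFamily ha h₁, memberSubfamily_joinFamily ha h₁',
    nonMemberSubfamily_joinFamily ha h₀, nonMemberSubfamily_joinFamily ha h₀']

theorem joinFamily_mono (h₀ : A₀ ⊆ B₀) (h₁ : A₁ ⊆ B₁) :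
    joinFamily a s A₀ A₁ ⊆ joinFamily a s B₀ B₁ := by
  intro B hB
  simp only [joinFamily, mem_filter] at hB ⊢
  exact ⟨hB.1, fun h => h₁ (hB.2.1 h), fun h => h₀ (hB.2.2 h)⟩

theorem IsUpperIn.joinFamily (h₀ : IsUpperIn s A₀) (h₁ : IsUpperIn s A₁) (h : A₀ ⊆ A₁) :
    IsUpperIn (insert a s) (joinFamily a s A₀ A₁) := by
  refine ⟨filter_subset _ _, fun A B hA hAB hB => ?_⟩
  simp only [_root_.joinFamily, mem_filter, mem_powerset] at hA ⊢
  refine ⟨hB, fun haB => ?_, fun haB => ?_⟩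
  · have hBs : B.erase a ⊆ s := subset_insert_iff.1 hB
    by_cases haA : a ∈ A
    · exact h₁.2 (hA.2.1 haA) (erase_subset_erase _ hAB) hBs
    · exact h₁.2 (h (hA.2.2 haA)) (subset_erase.2 ⟨hAB, haA⟩) hBs
  · exact h₀.2 (hA.2.2 fun haA => haB (hAB haA)) hAB ((subset_insert_iff_of_notMem haB).1 hB)

theorem IsLowerIn.joinFamily (h₀ : IsLowerIn s A₀) (h₁ : IsLowerIn s A₁) (h : A₁ ⊆ A₀) :
    IsLowerIn (insert a s) (joinFamily a s A₀ A₁) := by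
  refine ⟨filter_subset _ _, fun A B hA hBA => ?_⟩
  simp only [_root_.joinFamily, mem_filter, mem_powerset] at hA ⊢
  refine ⟨hBA.trans hA.1, fun haB => ?_, fun haB => ?_⟩
  · exact h₁.2 (hA.2.1 (hBA haB)) (erase_subset_erase _ hBA)
  · by_cases haA : a ∈ A
    · exact h₀.2 (h (hA.2.1 haA)) (subset_erase.2 ⟨hBA, haB⟩)
    · exact h₀.2 (hA.2.2 haA) hBA

end joinFamily

theorem exists_families_card_inter_eq_bitRevCount (s : Finset α) :
    ∃ U D : ℕ → Finset (Finset α), (∀ u, IsUpperIn s (U u)) ∧ (∀ d, IsLowerIn s (D d)) ∧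
      Monotone D ∧ (∀ u ≤ 2 ^ #s, #(U u) = u) ∧ (∀ d ≤ 2 ^ #s, #(D d) = d) ∧
      ∀ u ≤ 2 ^ #s, ∀ d ≤ 2 ^ #s, #(U u ∩ D d) = bitRevCount #s u d := by
  induction s using Finset.induction with
  | empty =>
    have hup : ∀ u : ℕ, IsUpperIn (∅ : Finset α) (if u = 0 then ∅ else {∅}) := by
      intro u
      split_ifs
      · exact ⟨by simp, by simp⟩
      · refine ⟨by simp, fun A B _ _ hB => ?_⟩
        simpa using hB
    have hlow : ∀ u : ℕ, IsLowerIn (∅ : Finset α) (if u = 0 then ∅ else {∅}) := by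
      intro u
      split_ifs
      · exact ⟨by simp, by simp⟩
      · refine ⟨by simp, fun A B hA hB => ?_⟩
        rw [mem_singleton] at hA ⊢
        exact subset_empty.1 (hA ▸ hB)
    refine ⟨fun u => if u = 0 then ∅ else {∅}, fun u => if u = 0 then ∅ else {∅}, hup, hlow,
      ?_, ?_, ?_, ?_⟩
    · intro d d' h
      by_cases hd : d = 0
      · simp [hd]
      · simp [hd, show d' ≠ 0 by omega]
    · intro u hu
      rw [card_empty, pow_zero] at hu
      interval_cases u <;> simp
    · intro u hu
      rw [card_empty, pow_zero] at hu
      interval_cases u <;> simp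
    · intro u hu d hd
      rw [card_empty, pow_zero] at hu hd
      interval_cases u <;> interval_cases d <;> simp [bitRevCount]
  | insert a s ha ih =>
    obtain ⟨U, D, hU, hD, hmono, hUc, hDc, hUD⟩ := ih
    have hp : 2 ^ (#s + 1) = 2 * 2 ^ #s := by ring
    have hfull : IsUpperIn s s.powerset := ⟨Subset.rfl, fun _ _ _ _ h => mem_powerset.2 h⟩
    have hempty : IsUpperIn s ∅ := ⟨by simp, by simp⟩
    rw [card_insert_of_notMem ha]
    refine ⟨fun u => if u ≤ 2 ^ #s then joinFamily a s ∅ (U u)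
        else joinFamily a s (U (u - 2 ^ #s)) s.powerset,
      fun d => joinFamily a s (D ((d + 1) / 2)) (D (d / 2)), ?_, ?_, ?_, ?_, ?_, ?_⟩
    · intro u
      dsimp only
      split_ifs
      · exact hempty.joinFamily (hU u) (empty_subset _)
      · exact (hU _).joinFamily hfull (hU _).1
    · exact fun d => (hD _).joinFamily (hD _) (hmono (by omega))
    · exact fun d d' h => joinFamily_mono (hmono (by omega)) (hmono (by omega))
    · intro u hu
      dsimp only
      split_ifs with h
      · rw [card_joinFamily ha (empty_subset _) (hU u).1, hUc u h, card_empty, add_zero]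
      · rw [card_joinFamily ha (hU _).1 Subset.rfl, hUc _ (by omega), card_powerset]
        omega
    · intro d hd
      rw [card_joinFamily ha (hD _).1 (hD _).1, hDc _ (by omega), hDc _ (by omega)]
      omega
    · intro u hu d hd
      dsimp only
      split_ifs with h
      · rw [card_joinFamily_inter ha (empty_subset _) (hU u).1 (hD _).1 (hD _).1,
          hUD u h _ (by omega), empty_inter, card_empty, add_zero, bitRevCount.succ_of_le _ h]
      · rw [card_joinFamily_inter ha (hU _).1 Subset.rfl (hD _).1 (hD _).1,
          hUD _ (by omega) _ (by omega), inter_eq_right.2 (hD _).1, hDc _ (by omega),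
          bitRevCount.succ_of_ge (by omega) hd]

end Families

theorem card_groundSet (n : ℕ) : #(groundSet n) = n := by
  simp [groundSet]

theorem isUpperIn_upClo (X : Finset ℕ) (F : Finset (Finset ℕ)) : IsUpperIn X (upClo X F) := by
  refine ⟨filter_subset _ _, fun A B hA hAB hB => ?_⟩
  obtain ⟨-, C, hC, hCA⟩ := mem_filter.1 hA
  exact mem_filter.2 ⟨mem_powerset.2 hB, C, hC, hCA.trans hAB⟩

theorem isLowerIn_downClo (X : Finset ℕ) (F : Finset (Finset ℕ)) :
    IsLowerIn X (downClo X F) := by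
  refine ⟨filter_subset _ _, fun A B hA hBA => ?_⟩
  obtain ⟨hAX, C, hC, hAC⟩ := mem_filter.1 hA
  exact mem_filter.2 ⟨mem_powerset.2 (hBA.trans (mem_powerset.1 hAX)), C, hC, hBA.trans hAC⟩

theorem subset_upClo_inter_downClo {X : Finset ℕ} {F : Finset (Finset ℕ)}
    (hF : F ⊆ X.powerset) : F ⊆ upClo X F ∩ downClo X F := fun A hA =>
  mem_inter.2 ⟨mem_filter.2 ⟨hF hA, A, hA, Subset.rfl⟩, mem_filter.2 ⟨hF hA, A, hA, Subset.rfl⟩⟩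

theorem udClo_subset_union {X : Finset ℕ} {F U D : Finset (Finset ℕ)} (hU : IsUpperIn X U)
    (hD : IsLowerIn X D) (hF : F ⊆ U ∩ D) : udClo X F ⊆ U ∪ D := by
  refine union_subset_union (fun A hA => ?_) (fun A hA => ?_)
  · obtain ⟨hAX, C, hC, hCA⟩ := mem_filter.1 hA
    exact hU.2 (mem_inter.1 (hF hC)).1 hCA (mem_powerset.1 hAX)
  · obtain ⟨-, C, hC, hAC⟩ := mem_filter.1 hA
    exact hD.2 (mem_inter.1 (hF hC)).2 hAC

theorem Phi_add_bitRevCount_le {n m u d : ℕ} (hu : u ≤ 2 ^ n) (hd : d ≤ 2 ^ n)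
    (hm : m ≤ bitRevCount n u d) : Phi n m + bitRevCount n u d ≤ u + d := by
  obtain ⟨U, D, hU, hD, -, hUc, hDc, hUD⟩ :=
    exists_families_card_inter_eq_bitRevCount (groundSet n)
  rw [card_groundSet] at hUc hDc hUD
  rw [← hUD u hu d hd] at hm ⊢
  obtain ⟨F, hF, hFc⟩ := exists_subset_card_eq hm
  have h1 : Phi n m ≤ #(udClo (groundSet n) F) :=
    Nat.sInf_le ⟨F, (hF.trans inter_subset_left).trans (hU u).1, hFc, rfl⟩
  have h2 := card_le_card (udClo_subset_union (hU u) (hD d) hF)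
  have h3 := card_union_add_card_inter (U u) (D d)
  rw [hUc u hu, hDc d hd] at h3
  omega

theorem exists_bitRevCount_eq_and_add_le_Phi_add {n m : ℕ} (hm : m ≤ 2 ^ n) :
    ∃ u ≤ 2 ^ n, ∃ d ≤ 2 ^ n, bitRevCount n u d = m ∧ u + d ≤ Phi n m + m := by
  have hne : {k | ∃ F : Finset (Finset ℕ), F ⊆ (groundSet n).powerset ∧ #F = m ∧
      #(udClo (groundSet n) F) = k}.Nonempty := by
    obtain ⟨F, hF, hFc⟩ := exists_subset_card_eq (s := (groundSet n).powerset) (n := m)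
      (by rwa [card_powerset, card_groundSet])
    exact ⟨_, F, hF, hFc, rfl⟩
  obtain ⟨F, hF, hFc, hPhi⟩ := Nat.sInf_mem hne
  change _ = Phi n m at hPhi
  have hU := isUpperIn_upClo (groundSet n) F
  have hD := isLowerIn_downClo (groundSet n) F
  have h1 := card_union_add_card_inter (upClo (groundSet n) F) (downClo (groundSet n) F)
  have h2 := card_inter_le_bitRevCount hU hD
  have h3 := card_le_card (subset_upClo_inter_downClo hF)
  have hu := card_le_two_pow_of_subset_powerset hU.1
  have hd := card_le_two_pow_of_subset_powerset hD.1
  rw [← udClo, hPhi] at h1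
  rw [card_groundSet] at h2 hu hd
  generalize #(upClo (groundSet n) F) = u at *
  generalize #(downClo (groundSet n) F) = d at *
  have hex : ∃ v, m ≤ bitRevCount n v d := ⟨u, by omega⟩
  have hv := Nat.find_spec hex
  have hvu : Nat.find hex ≤ u := Nat.find_min' hex (by omega)
  have hmin : ∀ w < Nat.find hex, bitRevCount n w d < m :=
    fun w hw => not_le.1 (Nat.find_min hex hw)
  generalize Nat.find hex = v at *
  have hveq : bitRevCount n v d = m := by
    rcases v with _ | v
    · rw [bitRevCount.zero_left] at hv ⊢
      omega
    · have := bitRevCount.left_le_add_sub (show v ≤ v + 1 by omega) (hvu.trans hu) hd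
      have := hmin v v.lt_succ_self
      omega
  have := bitRevCount.left_le_add_sub hvu hu hd
  exact ⟨v, hvu.trans hu, d, hd, hveq, by omega⟩

namespace bitRevCount

theorem add_two_mul_le_of_half_lt {k u d : ℕ} (hu : u ≤ 2 ^ (k + 2)) (hd : d ≤ 2 ^ (k + 2))
    (hm : bitRevCount (k + 2) u d ≤ 2 ^ k) (h : 2 ^ (k + 1) < u) :
    2 ^ (k + 1) + 2 * bitRevCount (k + 2) u d ≤ u + d := by
  have h1 := mul_two_pow_le hu hd
  generalize bitRevCount (k + 2) u d = m at *
  have hp : 2 ^ (k + 1) = 2 * 2 ^ k := by ring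
  have hp' : 2 ^ (k + 2) = 4 * 2 ^ k := by ring
  rw [hp] at h ⊢
  rw [hp'] at h1
  clear hu hd hp hp'
  generalize 2 ^ k = K at *
  by_contra! hlt
  zify at *
  nlinarith [mul_nonneg (sub_nonneg.2 h.le) (show (0 : ℤ) ≤ u - 2 * m by linarith),
    mul_pos (show (0 : ℤ) < u by omega) (sub_pos.2 hlt)]

theorem eq_half_half {k u d : ℕ} (hu : u ≤ 2 ^ (k + 1)) (hd : d ≤ 2 ^ (k + 1)) :
    bitRevCount (k + 2) u d = bitRevCount k (u / 2) (d / 2) := by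
  rw [succ_of_le _ hu, succ_of_right_le hu (by rw [pow_succ] at hd; omega)]

theorem eq_half_half_or_add_two_mul_le {k u d : ℕ} (hu : u ≤ 2 ^ (k + 2)) (hd : d ≤ 2 ^ (k + 2))
    (hm : bitRevCount (k + 2) u d ≤ 2 ^ k) :
    (u ≤ 2 ^ (k + 1) ∧ d ≤ 2 ^ (k + 1) ∧
      bitRevCount (k + 2) u d = bitRevCount k (u / 2) (d / 2)) ∨
    2 ^ (k + 1) + 2 * bitRevCount (k + 2) u d ≤ u + d := by
  by_cases h1 : u ≤ 2 ^ (k + 1)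
  · by_cases h2 : d ≤ 2 ^ (k + 1)
    · exact .inl ⟨h1, h2, eq_half_half h1 h2⟩
    · rw [comm hu hd] at hm ⊢
      rw [add_comm u]
      exact .inr (add_two_mul_le_of_half_lt hd hu hm (by omega))
  · exact .inr (add_two_mul_le_of_half_lt hu hd hm (by omega))

theorem half_left {k m : ℕ} (hm : m ≤ 2 ^ k) :
    bitRevCount (k + 2) (2 ^ (k + 1)) (2 * m) = m := by
  rw [eq_half_half le_rfl (by rw [pow_succ]; omega), pow_succ, Nat.mul_div_cancel _ two_pos,
    Nat.mul_div_cancel_left _ two_pos, full_left _ _ hm]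

end bitRevCount

theorem Phi_lt_Phi_succ {k m : ℕ} (hm : m < 2 ^ k) : Phi (k + 2) m < Phi (k + 2) (m + 1) := by
  have hp : 2 ^ (k + 1) = 2 * 2 ^ k := by ring
  have hp' : 2 ^ (k + 2) = 4 * 2 ^ k := by ring
  obtain ⟨u, hu, d, hd, hud, hle⟩ :=
    exists_bitRevCount_eq_and_add_le_Phi_add (show m + 1 ≤ 2 ^ (k + 2) by omega)
  rcases bitRevCount.eq_half_half_or_add_two_mul_le hu hd (by omega) with ⟨h1, h2, h3⟩ | h
  · rw [hud] at h3
    have h4 := bitRevCount.le_left (show u / 2 ≤ 2 ^ k by omega) (show d / 2 ≤ 2 ^ k by omega)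
    have h5 := bitRevCount.left_le_add_sub (show u / 2 - 1 ≤ u / 2 by omega)
      (show u / 2 ≤ 2 ^ k by omega) (show d / 2 ≤ 2 ^ k by omega)
    have h6 := bitRevCount.eq_half_half (show 2 * (u / 2 - 1) ≤ 2 ^ (k + 1) by omega)
      (show 2 * (d / 2) ≤ 2 ^ (k + 1) by omega)
    rw [Nat.mul_div_cancel_left _ two_pos, Nat.mul_div_cancel_left _ two_pos] at h6
    have h7 := Phi_add_bitRevCount_le (m := m) (show 2 * (u / 2 - 1) ≤ 2 ^ (k + 2) by omega)
      (show 2 * (d / 2) ≤ 2 ^ (k + 2) by omega) (by omega)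
    omega
  · have h1 := bitRevCount.half_left hm.le
    have h2 := Phi_add_bitRevCount_le (m := m) (show 2 ^ (k + 1) ≤ 2 ^ (k + 2) by omega)
      (show 2 * m ≤ 2 ^ (k + 2) by omega) h1.ge
    omega

theorem Phi_quarter (k : ℕ) : Phi (k + 2) (2 ^ k) = 3 * 2 ^ k := by
  have hp : 2 ^ (k + 1) = 2 * 2 ^ k := by ring
  have hp' : 2 ^ (k + 2) = 4 * 2 ^ k := by ring
  have h1 := bitRevCount.half_left (le_refl (2 ^ k))
  have h2 := Phi_add_bitRevCount_le (show 2 ^ (k + 1) ≤ 2 ^ (k + 2) by omega)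
    (show 2 * 2 ^ k ≤ 2 ^ (k + 2) by omega) h1.ge
  obtain ⟨u, hu, d, hd, hud, hle⟩ :=
    exists_bitRevCount_eq_and_add_le_Phi_add (show 2 ^ k ≤ 2 ^ (k + 2) by omega)
  rcases bitRevCount.eq_half_half_or_add_two_mul_le hu hd hud.le with ⟨h3, h4, h5⟩ | h
  · have h6 := bitRevCount.le_left (show u / 2 ≤ 2 ^ k by omega) (show d / 2 ≤ 2 ^ k by omega)
    have h7 := bitRevCount.le_right (show u / 2 ≤ 2 ^ k by omega) (show d / 2 ≤ 2 ^ k by omega)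
    omega
  · omega

/-- Lemma 14: for `n ≥ 2`, `Φ(n,0) = 0`, the sequence `Φ(n,0), Φ(n,1), …, Φ(n,2^(n-2))`
is strictly increasing, and `Φ(n,2^(n-2)) = 3 · 2^(n-2)`. -/
theorem stmt13 (n : ℕ) (hn : 2 ≤ n) :
    Phi n 0 = 0 ∧ (∀ m, m < 2 ^ (n - 2) → Phi n m < Phi n (m + 1)) ∧
    Phi n (2 ^ (n - 2)) = 3 * 2 ^ (n - 2) := by
  obtain ⟨k, rfl⟩ := Nat.exists_eq_add_of_le' hn
  refine ⟨?_, fun m hm => Phi_lt_Phi_succ hm, Phi_quarter k⟩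
  have := Phi_add_bitRevCount_le (n := k + 2) (Nat.zero_le _) (Nat.zero_le _) (Nat.zero_le _)
  omega
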